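/- The infinite series ∑_{k=1}^∞ (H_k · H_{k+1} · H_{k+2} · H_{k+3}) / (k·(k+1)·(k+2)·(k+3)) converges and equals -(4/9)·ζ(2) - (1/6)·ζ(2)·ζ(3) - (7/24)·ζ(3) + (191/144)·ζ(4) + (1/2)·ζ(5). -/

import Mathlib

/-- `harm k` is the `k`-th harmonic number `H_k = 1 + 1/2 + ⋯ + 1/k`. -/
noncomputable def harm (k : ℕ) : ℝ := ∑ i ∈ Finset.range k, (1 : ℝ) / (i + 1)

/-- `zeta m = ∑_{k=1}^∞ 1/k^m`, the Riemann zeta function at a natural argument. -/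
noncomputable def zeta (m : ℕ) : ℝ := ∑' n : ℕ, (1 : ℝ) / (n + 1) ^ m

open Filter Topology

lemma HasSum.congr_fun_val {f g : ℕ → ℝ} {a b : ℝ} (h : HasSum f a) (hfg : ∀ n, g n = f n)
    (hab : b = a) : HasSum g b :=
  hab ▸ h.congr_fun hfg

lemma harm_succ (k : ℕ) : harm (k + 1) = harm k + 1 / ((k : ℝ) + 1) := by
  simp [harm, Finset.sum_range_succ]

lemma harm_nonneg (k : ℕ) : 0 ≤ harm k := Finset.sum_nonneg fun i _ => by positivity

lemma harm_eq_harmonic (k : ℕ) : harm k = (harmonic k : ℝ) := by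
  simp [harm, harmonic]

lemma one_le_harm (k : ℕ) : 1 ≤ harm (k + 1) := by
  induction k with
  | zero => simp [harm]
  | succ k ih =>
    rw [harm_succ]
    have : (0 : ℝ) ≤ 1 / (((k + 1 : ℕ) : ℝ) + 1) := by positivity
    linarith

lemma harm_le_rpow (k : ℕ) : harm (k + 1) ≤ 9 * ((k : ℝ) + 1) ^ (1 / 8 : ℝ) := by
  have h1 := harmonic_le_one_add_log (k + 1)
  rw [← harm_eq_harmonic] at h1
  push_cast at h1
  have h2 := Real.log_le_rpow_div (x := (k : ℝ) + 1) (ε := 1 / 8) (by positivity) (by norm_num)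
  have h3 : (1 : ℝ) ≤ ((k : ℝ) + 1) ^ (1 / 8 : ℝ) :=
    Real.one_le_rpow (by linarith [k.cast_nonneg (α := ℝ)]) (by norm_num)
  linarith

lemma harm_pow_le (k : ℕ) {a : ℕ} (ha : a ≤ 4) :
    harm (k + 1) ^ a ≤ 9 ^ 4 * ((k : ℝ) + 1) ^ (1 / 2 : ℝ) := by
  calc harm (k + 1) ^ a ≤ harm (k + 1) ^ 4 := pow_le_pow_right₀ (one_le_harm k) ha
    _ ≤ (9 * ((k : ℝ) + 1) ^ (1 / 8 : ℝ)) ^ 4 :=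
        pow_le_pow_left₀ (harm_nonneg _) (harm_le_rpow k) 4
    _ = _ := by
        rw [mul_pow, ← Real.rpow_natCast, ← Real.rpow_natCast, ← Real.rpow_mul (by positivity)]
        norm_num

lemma tendsto_harm_pow_div (a : ℕ) (c : ℝ) (b : ℕ) (ha : a ≤ 4) (hb : 1 ≤ b) (hc : 0 ≤ c) :
    Tendsto (fun k : ℕ => harm (k + 1) ^ a / ((k : ℝ) + 1 + c) ^ b) atTop (𝓝 0) := by
  have hlim : Tendsto (fun k : ℕ => (9 ^ 4 : ℝ) * ((k : ℝ) + 1) ^ (-(1 / 2) : ℝ)) atTop (𝓝 0) := by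
    simpa using ((tendsto_rpow_neg_atTop (y := 1 / 2) (by norm_num)).comp
      (tendsto_atTop_add_const_right _ (1 : ℝ) tendsto_natCast_atTop_atTop)).const_mul (9 ^ 4 : ℝ)
  refine squeeze_zero (fun k => ?_) (fun k => ?_) hlim
  · have := harm_nonneg (k + 1)
    positivity
  · have hk : (0 : ℝ) < (k : ℝ) + 1 := by positivity
    have h1 : (k : ℝ) + 1 ≤ ((k : ℝ) + 1 + c) ^ b :=
      le_trans (by linarith) (le_self_pow₀ (by linarith [k.cast_nonneg (α := ℝ)]) (by omega))
    calc harm (k + 1) ^ a / ((k : ℝ) + 1 + c) ^ b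
        ≤ (9 ^ 4 * ((k : ℝ) + 1) ^ (1 / 2 : ℝ)) / ((k : ℝ) + 1) := by
          gcongr
          exact harm_pow_le k ha
      _ = 9 ^ 4 * ((k : ℝ) + 1) ^ (-(1 / 2) : ℝ) := by
          rw [mul_div_assoc, ← Real.rpow_sub_one hk.ne']
          norm_num

/-- A nonnegative series that differs from a convergent one by a telescoping series. -/
lemma hasSum_of_eq_add_telescoping {u b G : ℕ → ℝ} {s : ℝ} (hu : ∀ n, 0 ≤ u n)
    (h : ∀ n, u n = b n + (G (n + 1) - G n)) (hb : HasSum b s) (hG : Tendsto G atTop (𝓝 0)) :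
    HasSum u (s - G 0) := by
  rw [hasSum_iff_tendsto_nat_of_nonneg hu]
  have hsum : ∀ n, ∑ i ∈ Finset.range n, u i = ∑ i ∈ Finset.range n, b i + (G n - G 0) := by
    intro n
    simp only [h, Finset.sum_add_distrib, Finset.sum_range_sub]
  simp only [hsum]
  simpa [sub_eq_add_neg] using hb.tendsto_sum_nat.add (hG.sub_const (G 0))

lemma hasSum_swap_of_nonneg {f : ℕ → ℕ → ℝ} (hf : ∀ i j, 0 ≤ f i j) {g h : ℕ → ℝ} {s : ℝ}
    (hg : ∀ i, HasSum (f i) (g i)) (hs : HasSum g s) (hh : ∀ j, HasSum (fun i => f i j) (h j)) :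
    HasSum h s := by
  have hsum : Summable (fun p : ℕ × ℕ => f p.1 p.2) := by
    rw [summable_prod_of_nonneg (fun p => hf p.1 p.2)]
    exact ⟨fun i => (hg i).summable, by simpa only [(hg _).tsum_eq] using hs.summable⟩
  have h1 := hsum.hasSum.prod_fiberwise hg
  rw [hs.unique h1]
  exact ((Equiv.prodComm ℕ ℕ).hasSum_iff.2 hsum.hasSum).prod_fiberwise hh

lemma hasSum_zeta {m : ℕ} (hm : 2 ≤ m) : HasSum (fun n : ℕ => (1 : ℝ) / (n + 1) ^ m) (zeta m) := by
  have := (summable_nat_add_iff 1).2 (Real.summable_one_div_nat_pow.2 hm)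
  exact Summable.hasSum (by simpa using this)

lemma zeta_two_sq : zeta 2 * zeta 2 = 5 / 2 * zeta 4 := by
  have h2 := (hasSum_nat_add_iff' 1).2 hasSum_zeta_two
  have h4 := (hasSum_nat_add_iff' 1).2 hasSum_zeta_four
  have e2 := (hasSum_zeta le_rfl).unique (by simpa using h2)
  have e4 := (hasSum_zeta (m := 4) (by norm_num)).unique (by simpa using h4)
  rw [e2, e4]
  ring

lemma summable_one_div_rpow_three_halves :
    Summable (fun n : ℕ => 1 / ((n : ℝ) + 1) ^ (3 / 2 : ℝ)) := by
  have := (summable_nat_add_iff 1).2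
    (Real.summable_one_div_nat_rpow (p := 3 / 2) |>.2 (by norm_num))
  simpa using this

/-- The double zeta value `∑_{y > x ≥ 1} 1 / (x ^ b * y ^ a)`. -/
noncomputable def doubleZeta (a b : ℕ) : ℝ :=
  ∑' p : ℕ × ℕ, (1 : ℝ) / (((p.1 : ℝ) + 1) ^ b * ((p.1 : ℝ) + p.2 + 2) ^ a)

lemma hasSum_doubleZeta {a b : ℕ} (ha : 2 ≤ a) (hb : 1 ≤ b) :
    HasSum (fun p : ℕ × ℕ => (1 : ℝ) / (((p.1 : ℝ) + 1) ^ b * ((p.1 : ℝ) + p.2 + 2) ^ a))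
      (doubleZeta a b) := by
  refine Summable.hasSum ?_
  have h0 := summable_one_div_rpow_three_halves
  refine Summable.of_nonneg_of_le (fun p => by positivity) (fun p => ?_)
    (h0.mul_of_nonneg h0 (fun n => by positivity) (fun n => by positivity))
  obtain ⟨i, j⟩ := p
  have hi : (0 : ℝ) ≤ i := i.cast_nonneg
  have hj : (0 : ℝ) ≤ j := j.cast_nonneg
  have e1 : ((i : ℝ) + 1) ^ (3 / 2 : ℝ) = (i + 1) * ((i : ℝ) + 1) ^ (1 / 2 : ℝ) := by
    rw [← Real.rpow_one_add' (by positivity) (by norm_num)]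
    norm_num
  have e2 : ((i : ℝ) + j + 2) ^ 2
      = ((i : ℝ) + j + 2) ^ (1 / 2 : ℝ) * ((i : ℝ) + j + 2) ^ (3 / 2 : ℝ) := by
    rw [← Real.rpow_add (by positivity), ← Real.rpow_natCast]
    norm_num
  rw [one_div_mul_one_div]
  refine one_div_le_one_div_of_le (by positivity) ?_
  calc ((i : ℝ) + 1) ^ (3 / 2 : ℝ) * ((j : ℝ) + 1) ^ (3 / 2 : ℝ)
      = (i + 1) * (((i : ℝ) + 1) ^ (1 / 2 : ℝ) * ((j : ℝ) + 1) ^ (3 / 2 : ℝ)) := by rw [e1]; ring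
    _ ≤ (i + 1) * (((i : ℝ) + j + 2) ^ (1 / 2 : ℝ) * ((i : ℝ) + j + 2) ^ (3 / 2 : ℝ)) := by
        gcongr <;> linarith
    _ = (i + 1) * ((i : ℝ) + j + 2) ^ 2 := by rw [e2]
    _ ≤ (i + 1) ^ b * ((i : ℝ) + j + 2) ^ a := by
        gcongr
        · exact le_self_pow₀ (by linarith) (by omega)
        · linarith

lemma hasSum_powerSum_div {a b : ℕ} (ha : 2 ≤ a) (hb : 1 ≤ b) :
    HasSum (fun n : ℕ => (∑ i ∈ Finset.range n, (1 : ℝ) / ((i : ℝ) + 1) ^ b) / ((n : ℝ) + 1) ^ a)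
      (doubleZeta a b) := by
  have h := (Finset.HasAntidiagonal.sigmaAntidiagonalEquivProd (A := ℕ)).hasSum_iff.2
    (hasSum_doubleZeta ha hb)
  have h' := h.sigma (fun n => hasSum_fintype _)
  have h1 : HasSum (fun n : ℕ => (∑ i ∈ Finset.range (n + 1), (1 : ℝ) / ((i : ℝ) + 1) ^ b)
      / (((n + 1 : ℕ) : ℝ) + 1) ^ a) (doubleZeta a b) := by
    refine h'.congr_fun fun n => ?_
    simp only [Function.comp_apply, Finset.HasAntidiagonal.sigmaAntidiagonalEquivProd_apply]
    rw [Finset.sum_coe_sort (Finset.HasAntidiagonal.antidiagonal n) (fun p : ℕ × ℕ =>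
      (1 : ℝ) / (((p.1 : ℝ) + 1) ^ b * ((p.1 : ℝ) + p.2 + 2) ^ a)), Finset.sum_div,
      Finset.Nat.sum_antidiagonal_eq_sum_range_succ_mk]
    refine Finset.sum_congr rfl fun i hi => ?_
    rw [div_div, Nat.cast_sub (Finset.mem_range_succ_iff.1 hi)]
    push_cast
    ring_nf
  simpa using (hasSum_nat_add_iff (f := fun n : ℕ =>
    (∑ i ∈ Finset.range n, (1 : ℝ) / ((i : ℝ) + 1) ^ b) / ((n : ℝ) + 1) ^ a) 1).1 h1

lemma hasSum_harm_div_pow {a : ℕ} (ha : 2 ≤ a) :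
    HasSum (fun n : ℕ => harm (n + 1) / ((n : ℝ) + 1) ^ a) (doubleZeta a 1 + zeta (a + 1)) := by
  refine ((hasSum_powerSum_div ha le_rfl).add (hasSum_zeta (m := a + 1) (by omega))).congr_fun
    fun n => ?_
  simp only [pow_one]
  rw [harm_succ, harm, pow_succ]
  field_simp

/-- The stuffle product of two zeta values. -/
lemma zeta_mul_zeta {a b : ℕ} (ha : 2 ≤ a) (hb : 2 ≤ b) :
    zeta a * zeta b = doubleZeta a b + doubleZeta b a + zeta (a + b) := by
  have htail : ∀ n : ℕ, HasSum (fun j : ℕ => (1 : ℝ) / (((n : ℝ) + 1) ^ a * ((n : ℝ) + j + 2) ^ b))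
      (1 / ((n : ℝ) + 1) ^ a *
        (zeta b - ∑ i ∈ Finset.range (n + 1), (1 : ℝ) / ((i : ℝ) + 1) ^ b)) := by
    intro n
    have h := ((hasSum_nat_add_iff' (n + 1)).2 (hasSum_zeta hb)).mul_left (1 / ((n : ℝ) + 1) ^ a)
    refine h.congr_fun fun j => ?_
    rw [one_div_mul_one_div]
    push_cast
    ring_nf
  have h1 := (hasSum_doubleZeta hb (b := a) (by omega)).prod_fiberwise htail
  have h2 := ((hasSum_powerSum_div ha (b := b) (by omega)).add h1).add
    (hasSum_zeta (m := a + b) (by omega))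
  refine ((hasSum_zeta ha).mul_right (zeta b)).unique ?_
  refine h2.congr_fun fun n => ?_
  rw [Finset.sum_range_succ, pow_add]
  field_simp
  ring

lemma hasSum_harm_eq (k : ℕ) :
    HasSum (fun n : ℕ => 1 / ((n : ℝ) + 1) - 1 / ((n : ℝ) + 1 + k)) (harm k) := by
  induction k with
  | zero => simp [harm, hasSum_zero]
  | succ k ih =>
    have h := hasSum_of_eq_add_telescoping
      (u := fun n : ℕ => 1 / ((n : ℝ) + 1 + k) - 1 / ((n : ℝ) + 1 + (k + 1 : ℕ)))
      (b := fun _ => 0) (G := fun n : ℕ => -(1 / ((n : ℝ) + 1 + k)))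
      (fun n => ?_) (fun n => ?_) hasSum_zero ?_
    · convert ih.add h using 2
      · ring
      · rw [harm_succ]
        simp [add_comm]
    · rw [sub_nonneg]
      push_cast
      gcongr
      linarith
    · push_cast
      ring
    · simpa using (tendsto_harm_pow_div 0 k 1 (by norm_num) le_rfl (by positivity)).neg

lemma hasSum_one_div_mul_add (k : ℕ) :
    HasSum (fun n : ℕ => 1 / (((n : ℝ) + 1) * ((k : ℝ) + n + 2))) (harm (k + 1) / ((k : ℝ) + 1)) := by
  refine ((hasSum_harm_eq (k + 1)).div_const ((k : ℝ) + 1)).congr_fun fun n => ?_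
  push_cast
  field_simp
  ring

lemma one_div_mul_pow_mul_add {x y : ℝ} (hx : 0 < x) (hy : 0 < y) (m : ℕ) :
    1 / (y * x ^ (m + 1) * (x + y)) =
      ∑ r ∈ Finset.range (m + 1), 1 / (x ^ (r + 1) * (x + y) ^ (m + 2 - r))
        + 1 / (y * (x + y) ^ (m + 2)) := by
  induction m with
  | zero => simp; field_simp; ring
  | succ m ih =>
    rw [Finset.sum_range_succ']
    have h1 : ∑ r ∈ Finset.range (m + 1), 1 / (x ^ (r + 1 + 1) * (x + y) ^ (m + 1 + 2 - (r + 1)))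
        = 1 / x * ∑ r ∈ Finset.range (m + 1), 1 / (x ^ (r + 1) * (x + y) ^ (m + 2 - r)) := by
      rw [Finset.mul_sum]
      refine Finset.sum_congr rfl fun r _ => ?_
      rw [show m + 1 + 2 - (r + 1) = m + 2 - r by omega, one_div_mul_one_div]
      ring
    rw [h1, eq_sub_of_add_eq ih.symm]
    simp only [Nat.sub_zero, zero_add, pow_one]
    field_simp
    ring

/-- The sum formula for double zeta values. -/
lemma sum_doubleZeta (m : ℕ) :
    ∑ r ∈ Finset.range (m + 1), doubleZeta (m + 2 - r) (r + 1) = zeta (m + 3) := by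
  have h1 : HasSum (fun p : ℕ × ℕ =>
      ∑ r ∈ Finset.range (m + 1),
        (1 : ℝ) / (((p.1 : ℝ) + 1) ^ (r + 1) * ((p.1 : ℝ) + p.2 + 2) ^ (m + 2 - r)))
      (∑ r ∈ Finset.range (m + 1), doubleZeta (m + 2 - r) (r + 1)) :=
    hasSum_sum fun r hr => hasSum_doubleZeta (by have := Finset.mem_range.1 hr; omega) (by omega)
  have h2 := (Equiv.prodComm ℕ ℕ).hasSum_iff.2
    (hasSum_doubleZeta (a := m + 2) (b := 1) (by omega) le_rfl)
  have h3 : ∀ i : ℕ, HasSum (fun j : ℕ =>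
      ∑ r ∈ Finset.range (m + 1),
        (1 : ℝ) / (((i : ℝ) + 1) ^ (r + 1) * ((i : ℝ) + j + 2) ^ (m + 2 - r))
      + 1 / (((j : ℝ) + 1) ^ 1 * ((j : ℝ) + i + 2) ^ (m + 2)))
      (harm (i + 1) / ((i : ℝ) + 1) ^ (m + 2)) := by
    intro i
    refine ((hasSum_one_div_mul_add i).mul_left (1 / ((i : ℝ) + 1) ^ (m + 1))).congr_fun_val
      (fun j => ?_) ?_
    · have h := one_div_mul_pow_mul_add (x := (i : ℝ) + 1) (y := (j : ℝ) + 1)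
        (by positivity) (by positivity) m
      rw [show (i : ℝ) + 1 + (j + 1) = i + j + 2 by ring] at h
      rw [pow_one, show (j : ℝ) + i + 2 = i + j + 2 by ring, ← h, one_div_mul_one_div]
      ring
    · rw [pow_succ]
      field_simp
  have h4 := ((h1.add h2).prod_fiberwise h3).unique (hasSum_harm_div_pow (a := m + 2) (by omega))
  linarith

lemma doubleZeta_two_two : doubleZeta 2 2 = 3 / 4 * zeta 4 := by
  have h1 := zeta_mul_zeta (a := 2) (b := 2) le_rfl le_rfl
  have h2 := zeta_two_sq
  norm_num at h1
  linarith

lemma doubleZeta_two_one : doubleZeta 2 1 = zeta 3 := by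
  simpa using sum_doubleZeta 0

lemma doubleZeta_three_one : doubleZeta 3 1 = 1 / 4 * zeta 4 := by
  have h := sum_doubleZeta 1
  simp [Finset.sum_range_succ, doubleZeta_two_two] at h
  linarith

lemma doubleZeta_four_one : doubleZeta 4 1 = 2 * zeta 5 - zeta 2 * zeta 3 := by
  have h := sum_doubleZeta 2
  have h1 := zeta_mul_zeta (a := 2) (b := 3) le_rfl (by norm_num)
  simp [Finset.sum_range_succ] at h h1
  linarith

lemma hasSum_harm_div_mul_succ {c s : ℝ} (hc : 0 ≤ c)
    (hs : HasSum (fun k : ℕ => 1 / (((k : ℝ) + 1) * ((k : ℝ) + 1 + c))) s) :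
    HasSum (fun k : ℕ => harm (k + 1) * (1 / ((k : ℝ) + 1 + c) - 1 / ((k : ℝ) + 1 + (c + 1)))) s := by
  have h := hasSum_of_eq_add_telescoping
    (u := fun k : ℕ => harm (k + 1) * (1 / ((k : ℝ) + 1 + c) - 1 / ((k : ℝ) + 1 + (c + 1))))
    (G := fun k : ℕ => -(harm (k + 1) ^ 1 / ((k : ℝ) + 1 + c) ^ 1)
      + 1 / (((k : ℝ) + 1) * ((k : ℝ) + 1 + c)))
    (fun k => ?_) (fun k => ?_) hs ?_
  · simpa [harm] using h
  · refine mul_nonneg (harm_nonneg _) (sub_nonneg.2 ?_)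
    gcongr
    linarith
  · rw [harm_succ (k + 1)]
    push_cast
    field_simp
    ring
  · simpa using (tendsto_harm_pow_div 1 c 1 (by norm_num) le_rfl hc).neg.add
      hs.summable.tendsto_atTop_zero

lemma hasSum_harm_mul_sub (n : ℕ) :
    HasSum (fun k : ℕ => harm (k + 1) * (1 / ((k : ℝ) + 1) - 1 / ((k : ℝ) + 1 + (n + 1))))
      (zeta 2 + 1 / 2 * (harm n ^ 2 + ∑ i ∈ Finset.range n, (1 : ℝ) / ((i : ℝ) + 1) ^ 2)) := by
  induction n with
  | zero =>
    have h := hasSum_harm_div_mul_succ (c := 0) le_rfl (s := zeta 2) (by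
      convert hasSum_zeta (m := 2) le_rfl using 2
      ring)
    simpa [harm] using h
  | succ n ih =>
    have h := hasSum_harm_div_mul_succ (c := (n : ℝ) + 1) (by positivity)
      (s := harm (n + 1) / ((n : ℝ) + 1)) (by
        convert hasSum_one_div_mul_add n using 3
        ring)
    refine (ih.add h).congr_fun_val (fun k => ?_) ?_
    · push_cast
      ring
    · rw [Finset.sum_range_succ, harm_succ]
      field_simp
      ring

lemma hasSum_harm_sq_div_sq :
    HasSum (fun n : ℕ => harm (n + 1) ^ 2 / ((n : ℝ) + 1) ^ 2) (17 / 4 * zeta 4) := by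
  have hsum : Summable (fun n : ℕ => harm (n + 1) ^ 2 / ((n : ℝ) + 1) ^ 2) := by
    refine Summable.of_nonneg_of_le (fun n => by positivity) (fun n => ?_)
      (summable_one_div_rpow_three_halves.mul_left (9 ^ 4))
    have hn : (0 : ℝ) < (n : ℝ) + 1 := by positivity
    calc harm (n + 1) ^ 2 / ((n : ℝ) + 1) ^ 2
        ≤ (9 ^ 4 * ((n : ℝ) + 1) ^ (1 / 2 : ℝ)) / ((n : ℝ) + 1) ^ 2 := by
          gcongr
          exact harm_pow_le n (by norm_num)
      _ = 9 ^ 4 * (1 / ((n : ℝ) + 1) ^ (3 / 2 : ℝ)) := by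
          rw [mul_div_assoc, one_div ((_ : ℝ) ^ _), ← Real.rpow_neg hn.le,
            ← Real.rpow_natCast (_ + 1), ← Real.rpow_sub hn]
          norm_num
  obtain ⟨X, hX⟩ := hsum
  have hrows : HasSum (fun n : ℕ => (zeta 2 + 1 / 2 * (harm n ^ 2
      + ∑ i ∈ Finset.range n, (1 : ℝ) / ((i : ℝ) + 1) ^ 2)) / ((n : ℝ) + 1) ^ 2) X := by
    refine hasSum_swap_of_nonneg
      (f := fun k n => harm (k + 1) / (((k : ℝ) + 1) * ((n : ℝ) + 1) * ((k : ℝ) + n + 2)))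
      (fun k n => ?_) (fun k => ?_) hX (fun n => ?_)
    · have := harm_nonneg (k + 1)
      positivity
    · refine ((hasSum_one_div_mul_add k).mul_left (harm (k + 1) / ((k : ℝ) + 1))).congr_fun_val
        (fun n => ?_) ?_ <;> field_simp
    · refine ((hasSum_harm_mul_sub n).div_const (((n : ℝ) + 1) ^ 2)).congr_fun fun k => ?_
      field_simp
      ring
  have h1 := (((hasSum_zeta (m := 2) le_rfl).mul_left (zeta 2)).add
    ((((hX.sub ((hasSum_harm_div_pow (a := 3) (by norm_num)).mul_left 2)).add
      (hasSum_zeta (m := 4) (by norm_num))).add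
      (hasSum_powerSum_div (a := 2) (b := 2) le_rfl (by norm_num))).mul_left (1 / 2)))
  have h2 := hrows.unique (h1.congr_fun fun n => by
    rw [harm_succ]
    field_simp
    ring)
  rw [zeta_two_sq, doubleZeta_two_two, doubleZeta_three_one] at h2
  rwa [show 17 / 4 * zeta 4 = X by linarith]

/-- The telescoping part of the series in `stmt_0`. -/
noncomputable def harmTelescope (k : ℕ) : ℝ :=
  -(1 / 6 * (harm (k + 1) ^ 4 / ((k : ℝ) + 1 + 2)))
    + 1 / 3 * (harm (k + 1) ^ 4 / ((k : ℝ) + 1 + 1))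
    - 1 / 6 * (harm (k + 1) ^ 4 / ((k : ℝ) + 1))
    - 1 / 6 * (harm (k + 1) ^ 3 / ((k : ℝ) + 1 + 2) ^ 2)
    - 1 / 18 * (harm (k + 1) ^ 3 / ((k : ℝ) + 1 + 2))
    + 5 / 6 * (harm (k + 1) ^ 3 / ((k : ℝ) + 1 + 1) ^ 2)
    + 7 / 9 * (harm (k + 1) ^ 3 / ((k : ℝ) + 1 + 1))
    - 13 / 18 * (harm (k + 1) ^ 3 / ((k : ℝ) + 1))
    + 1 / 12 * (harm (k + 1) ^ 2 / ((k : ℝ) + 1 + 2) ^ 2)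
    + 5 / 18 * (harm (k + 1) ^ 2 / ((k : ℝ) + 1 + 2))
    + 1 / 2 * (harm (k + 1) ^ 2 / ((k : ℝ) + 1 + 1) ^ 3)
    + 4 / 3 * (harm (k + 1) ^ 2 / ((k : ℝ) + 1 + 1) ^ 2)
    + 71 / 72 * (harm (k + 1) ^ 2 / ((k : ℝ) + 1 + 1))
    + 1 / 4 * (harm (k + 1) ^ 2 / ((k : ℝ) + 1) ^ 2)
    - 73 / 72 * (harm (k + 1) ^ 2 / ((k : ℝ) + 1))
    + 1 / 12 * (harm (k + 1) / ((k : ℝ) + 1 + 2) ^ 2)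
    + 7 / 36 * (harm (k + 1) / ((k : ℝ) + 1 + 2))
    + 1 / 2 * (harm (k + 1) / ((k : ℝ) + 1 + 1) ^ 3)
    + harm (k + 1) / ((k : ℝ) + 1 + 1) ^ 2
    + 17 / 24 * (harm (k + 1) / ((k : ℝ) + 1 + 1))
    + 1 / 6 * (harm (k + 1) / ((k : ℝ) + 1) ^ 4)
    + 1 / 6 * (harm (k + 1) / ((k : ℝ) + 1) ^ 3)
    - 1 / 18 * (harm (k + 1) / ((k : ℝ) + 1) ^ 2)
    - 11 / 24 * (harm (k + 1) / ((k : ℝ) + 1))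
    + 1 / 18 * (1 / ((k : ℝ) + 1) ^ 4)
    - 13 / 72 * (1 / ((k : ℝ) + 1) ^ 3)
    - 4 / 9 * (1 / ((k : ℝ) + 1) ^ 2)

lemma tendsto_harmTelescope : Tendsto harmTelescope atTop (𝓝 0) := by
  have L (a j b : ℕ) (ha : a ≤ 4 := by norm_num) (hb : 1 ≤ b := by norm_num) :=
    tendsto_harm_pow_div a j b ha hb j.cast_nonneg
  have h := ((L 4 2 1).const_mul (1 / 6)).neg
    |>.add ((L 4 1 1).const_mul (1 / 3))
    |>.sub ((L 4 0 1).const_mul (1 / 6))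
    |>.sub ((L 3 2 2).const_mul (1 / 6))
    |>.sub ((L 3 2 1).const_mul (1 / 18))
    |>.add ((L 3 1 2).const_mul (5 / 6))
    |>.add ((L 3 1 1).const_mul (7 / 9))
    |>.sub ((L 3 0 1).const_mul (13 / 18))
    |>.add ((L 2 2 2).const_mul (1 / 12))
    |>.add ((L 2 2 1).const_mul (5 / 18))
    |>.add ((L 2 1 3).const_mul (1 / 2))
    |>.add ((L 2 1 2).const_mul (4 / 3))
    |>.add ((L 2 1 1).const_mul (71 / 72))
    |>.add ((L 2 0 2).const_mul (1 / 4))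
    |>.sub ((L 2 0 1).const_mul (73 / 72))
    |>.add ((L 1 2 2).const_mul (1 / 12))
    |>.add ((L 1 2 1).const_mul (7 / 36))
    |>.add ((L 1 1 3).const_mul (1 / 2))
    |>.add ((L 1 1 2).const_mul (1 : ℝ))
    |>.add ((L 1 1 1).const_mul (17 / 24))
    |>.add ((L 1 0 4).const_mul (1 / 6))
    |>.add ((L 1 0 3).const_mul (1 / 6))
    |>.sub ((L 1 0 2).const_mul (1 / 18))
    |>.sub ((L 1 0 1).const_mul (11 / 24))
    |>.add ((L 0 0 4).const_mul (1 / 18))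
    |>.sub ((L 0 0 3).const_mul (13 / 72))
    |>.sub ((L 0 0 2).const_mul (4 / 9))
  refine Tendsto.congr (fun k => ?_) (by simpa using h)
  simp [harmTelescope]

lemma harm_mul_div_eq (k : ℕ) :
    (harm (k + 1) * harm (k + 2) * harm (k + 3) * harm (k + 4)) /
        (((k : ℝ) + 1) * ((k : ℝ) + 2) * ((k : ℝ) + 3) * ((k : ℝ) + 4)) =
      (1 / 6 * (harm (k + 1) / ((k : ℝ) + 1) ^ 4) + 1 / 6 * (harm (k + 1) / ((k : ℝ) + 1) ^ 3)
        - 1 / 18 * (harm (k + 1) / ((k : ℝ) + 1) ^ 2)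
        + 1 / 4 * (harm (k + 1) ^ 2 / ((k : ℝ) + 1) ^ 2)
        + 1 / 18 * (1 / ((k : ℝ) + 1) ^ 4) - 13 / 72 * (1 / ((k : ℝ) + 1) ^ 3)
        - 4 / 9 * (1 / ((k : ℝ) + 1) ^ 2))
      + (harmTelescope (k + 1) - harmTelescope k) := by
  simp only [harmTelescope, harm_succ (k + 1), harm_succ (k + 2), harm_succ (k + 3)]
  push_cast
  generalize harm (k + 1) = h
  obtain ⟨x, hx⟩ : ∃ x : ℝ, (k : ℝ) = x - 1 := ⟨k + 1, by ring⟩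
  have hx0 : 0 < x := by linarith [k.cast_nonneg (α := ℝ)]
  rw [hx]
  ring_nf
  field_simp
  ring

theorem stmt_0 :
    HasSum (fun k : ℕ =>
      (harm (k + 1) * harm (k + 2) * harm (k + 3) * harm (k + 4)) /
        (((k : ℝ) + 1) * ((k : ℝ) + 2) * ((k : ℝ) + 3) * ((k : ℝ) + 4)))
      (-(4 / 9) * zeta 2 - (1 / 6) * zeta 2 * zeta 3 - (7 / 24) * zeta 3
        + (191 / 144) * zeta 4 + (1 / 2) * zeta 5) := by
  have h := hasSum_of_eq_add_telescoping (fun k => ?_) harm_mul_div_eq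
    ((((((((hasSum_harm_div_pow (a := 4) (by norm_num)).mul_left (1 / 6)).add
      ((hasSum_harm_div_pow (a := 3) (by norm_num)).mul_left (1 / 6))).sub
      ((hasSum_harm_div_pow (a := 2) le_rfl).mul_left (1 / 18))).add
      (hasSum_harm_sq_div_sq.mul_left (1 / 4))).add
      ((hasSum_zeta (m := 4) (by norm_num)).mul_left (1 / 18))).sub
      ((hasSum_zeta (m := 3) (by norm_num)).mul_left (13 / 72))).sub
      ((hasSum_zeta (m := 2) le_rfl).mul_left (4 / 9))) tendsto_harmTelescope
  · refine h.congr_fun_val (fun _ => rfl) ?_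
    have h0 : harmTelescope 0 = 0 := by norm_num [harmTelescope, harm]
    rw [h0, doubleZeta_four_one, doubleZeta_three_one, doubleZeta_two_one]
    ring
  · have := harm_nonneg (k + 1)
    have := harm_nonneg (k + 2)
    have := harm_nonneg (k + 3)
    have := harm_nonneg (k + 4)
    positivity
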